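/- Let k, h ≥ 1 and let u ∈ F_n^k and w ∈ F_n^h be unitaries satisfying the coupled equations u_h w u_h* = u* and w_k u w_k* = w*. Set r = max(k,h) and v := u_r* u* u_r. Then u satisfies the polynomial matrix equation v_r u v_r* = u_r* u u_r, where v_r := vφ(v)φ²(v)⋯φ^{r-1}(v). -/

import Mathlib

noncomputable section CuntzSetup

/-- The word `S_μ = S_{μ₁} ⋯ S_{μ_k}` associated to a multi-index `μ ∈ {1,…,n}^k`. -/
def cuntzWord {A : Type*} [Monoid A] {n k : ℕ} (S : Fin n → A) (μ : Fin k → Fin n) : A :=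
  (List.ofFn fun i => S (μ i)).prod

/-- The canonical shift `φ(x) = ∑ᵢ Sᵢ x Sᵢ*`. -/
def cuntzPhi {A : Type*} [Ring A] [StarRing A] {n : ℕ} (S : Fin n → A) (x : A) : A :=
  ∑ i, S i * x * star (S i)

/-- `u_k = u φ(u) φ²(u) ⋯ φ^{k-1}(u)`. -/
def cuntzUk {A : Type*} [Ring A] [StarRing A] {n : ℕ} (S : Fin n → A) (u : A) (k : ℕ) : A :=
  ((List.range k).map fun j => (cuntzPhi S)^[j] u).prod

/-- `F_n^k`, the linear span of `{S_μ S_ν* : |μ| = |ν| = k}`. -/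
def cuntzF {A : Type*} [Ring A] [StarRing A] [Algebra ℂ A] {n : ℕ} (S : Fin n → A) (k : ℕ) :
    Submodule ℂ A :=
  Submodule.span ℂ {x | ∃ μ ν : Fin k → Fin n, x = cuntzWord S μ * star (cuntzWord S ν)}

end CuntzSetup

section CuntzLemmas

/-- Isometries satisfying the Cuntz relation have pairwise orthogonal ranges. -/
theorem cuntz_star_mul_of_ne {A : Type*} [CStarAlgebra A] {n : ℕ} {S : Fin n → A}
    (hiso : ∀ i, star (S i) * S i = 1) (hcuntz : ∑ i, S i * star (S i) = 1)
    {i j : Fin n} (hij : i ≠ j) : star (S i) * S j = 0 := by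
  let := CStarAlgebra.spectralOrder A
  have := CStarAlgebra.spectralOrderedRing A
  have hsum : ∑ l, star (star (S l) * S j) * (star (S l) * S j) = 1 :=
    calc _ = star (S j) * (∑ l, S l * star (S l)) * S j := by
          simp only [star_mul, star_star, Finset.mul_sum, Finset.sum_mul, mul_assoc]
      _ = 1 := by rw [hcuntz, mul_one, hiso]
  have hrest : ∑ l ∈ Finset.univ.erase j, star (star (S l) * S j) * (star (S l) * S j) = 0 := by
    rw [← Finset.add_sum_erase _ _ (Finset.mem_univ j)] at hsum
    rwa [hiso, star_one, one_mul, add_eq_left] at hsum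
  rw [Finset.sum_eq_zero_iff_of_nonneg fun l _ => star_mul_self_nonneg _] at hrest
  exact CStarRing.star_mul_self_eq_zero_iff _ |>.1
    (hrest i (Finset.mem_erase.2 ⟨hij, Finset.mem_univ i⟩))

variable {A : Type*} [Ring A] [StarRing A] {n : ℕ} {S : Fin n → A}

theorem cuntzPhi_star (x : A) : cuntzPhi S (star x) = star (cuntzPhi S x) := by
  simp [cuntzPhi, star_sum, mul_assoc]

theorem cuntzPhi_mul_generator (horth : ∀ i j, star (S i) * S j = if i = j then 1 else 0)
    (x : A) (i : Fin n) : cuntzPhi S x * S i = S i * x := by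
  simp [cuntzPhi, Finset.sum_mul, mul_assoc, horth]

/-- The canonical shift as a monoid homomorphism. -/
def cuntzPhiHom (horth : ∀ i j, star (S i) * S j = if i = j then 1 else 0)
    (hcuntz : ∑ i, S i * star (S i) = 1) : A →* A where
  toFun := cuntzPhi S
  map_one' := by simpa [cuntzPhi] using hcuntz
  map_mul' x y := by
    conv_rhs => rw [cuntzPhi.eq_def S y, Finset.mul_sum]
    refine Finset.sum_congr rfl fun i _ => ?_
    simp only [← mul_assoc, cuntzPhi_mul_generator horth]

theorem cuntzPhi_iterate_mul_word (horth : ∀ i j, star (S i) * S j = if i = j then 1 else 0)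
    (x : A) {k : ℕ} (μ : Fin k → Fin n) :
    (cuntzPhi S)^[k] x * cuntzWord S μ = cuntzWord S μ * x := by
  induction k with
  | zero => simp [cuntzWord]
  | succ k ih =>
    have hword : cuntzWord S μ = S (μ 0) * cuntzWord S (fun i => μ i.succ) := by
      simp [cuntzWord, List.ofFn_succ]
    rw [hword, Function.iterate_succ_apply', ← mul_assoc, cuntzPhi_mul_generator horth,
      mul_assoc, ih, mul_assoc]

theorem cuntzPhi_iterate_star (k : ℕ) (x : A) :
    (cuntzPhi S)^[k] (star x) = star ((cuntzPhi S)^[k] x) :=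
  (Function.Commute.iterate_left (fun x => cuntzPhi_star x) k) x

/-- `F_n^k` commutes with the range of `φ^k`. -/
theorem commute_cuntzPhi_iterate_of_mem_cuntzF [Algebra ℂ A]
    (horth : ∀ i j, star (S i) * S j = if i = j then 1 else 0) {k : ℕ} {y : A}
    (hy : y ∈ cuntzF S k) (x : A) : Commute ((cuntzPhi S)^[k] x) y := by
  induction hy using Submodule.span_induction with
  | mem y hy =>
    obtain ⟨μ, ν, rfl⟩ := hy
    have hν := congrArg star (cuntzPhi_iterate_mul_word horth (star x) ν)
    rw [cuntzPhi_iterate_star, star_mul, star_mul, star_star, star_star] at hν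
    rw [commute_iff_eq, ← mul_assoc, cuntzPhi_iterate_mul_word horth, mul_assoc, mul_assoc, hν]
  | zero => exact Commute.zero_right _
  | add y z _ _ hy hz => exact hy.add_right hz
  | smul c y _ hy => exact hy.smul_right c

theorem cuntzUk_succ (u : A) (k : ℕ) :
    cuntzUk S u (k + 1) = cuntzUk S u k * (cuntzPhi S)^[k] u := by
  simp [cuntzUk, List.range_succ]

theorem cuntzUk_add (horth : ∀ i j, star (S i) * S j = if i = j then 1 else 0)
    (hcuntz : ∑ i, S i * star (S i) = 1) (u : A) (a b : ℕ) :
    cuntzUk S u (a + b) = cuntzUk S u a * (cuntzPhi S)^[a] (cuntzUk S u b) := by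
  induction b with
  | zero =>
    have := iterate_map_one (cuntzPhiHom horth hcuntz) a
    simp only [cuntzUk, add_zero, List.range_zero, List.map_nil, List.prod_nil]
    exact ((congrArg _ this).trans (mul_one _)).symm
  | succ b ih =>
    have := iterate_map_mul (cuntzPhiHom horth hcuntz) a (cuntzUk S u b) ((cuntzPhi S)^[b] u)
    rw [← add_assoc, cuntzUk_succ, ih, cuntzUk_succ, mul_assoc, Function.iterate_add_apply]
    exact congrArg _ this.symm

theorem cuntzPhi_iterate_mem_unitary
    (horth : ∀ i j, star (S i) * S j = if i = j then 1 else 0)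
    (hcuntz : ∑ i, S i * star (S i) = 1) {u : A} (hu : u ∈ unitary A) (k : ℕ) :
    (cuntzPhi S)^[k] u ∈ unitary A := by
  have hmul (x y : A) : (cuntzPhi S)^[k] x * (cuntzPhi S)^[k] y = (cuntzPhi S)^[k] (x * y) :=
    (iterate_map_mul (cuntzPhiHom horth hcuntz) k x y).symm
  have hone : (cuntzPhi S)^[k] 1 = 1 := iterate_map_one (cuntzPhiHom horth hcuntz) k
  rw [Unitary.mem_iff] at hu ⊢
  simp only [← cuntzPhi_iterate_star, hmul, hu, hone, and_self]

theorem cuntzUk_mem_unitary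
    (horth : ∀ i j, star (S i) * S j = if i = j then 1 else 0)
    (hcuntz : ∑ i, S i * star (S i) = 1) {u : A} (hu : u ∈ unitary A) (k : ℕ) :
    cuntzUk S u k ∈ unitary A := by
  induction k with
  | zero => simp [cuntzUk]
  | succ k ih =>
    rw [cuntzUk_succ]
    exact mul_mem ih (cuntzPhi_iterate_mem_unitary horth hcuntz hu k)

/-- Conjugation of `y ∈ F_n^k` by `u_r` does not depend on `r ≥ k`. -/
theorem cuntzUk_conj_eq_of_le [Algebra ℂ A]
    (horth : ∀ i j, star (S i) * S j = if i = j then 1 else 0)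
    (hcuntz : ∑ i, S i * star (S i) = 1) {u : A} (hu : u ∈ unitary A) {k r : ℕ} (hkr : k ≤ r)
    {y : A} (hy : y ∈ cuntzF S k) :
    cuntzUk S u r * y * star (cuntzUk S u r) = cuntzUk S u k * y * star (cuntzUk S u k) := by
  obtain ⟨b, rfl⟩ := Nat.exists_eq_add_of_le hkr
  have hx := cuntzPhi_iterate_mem_unitary horth hcuntz
    (cuntzUk_mem_unitary horth hcuntz hu b) k
  have hcomm := commute_cuntzPhi_iterate_of_mem_cuntzF horth hy (cuntzUk S u b)
  rw [cuntzUk_add horth hcuntz, star_mul]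
  generalize (cuntzPhi S)^[k] (cuntzUk S u b) = x at hx hcomm
  rw [mul_assoc (cuntzUk S u k), hcomm.eq, ← mul_assoc, ← mul_assoc, mul_assoc _ x,
    Unitary.mul_star_self_of_mem hx, mul_one]

end CuntzLemmas

/-- if unitaries `u ∈ F_n^k`, `w ∈ F_n^h` satisfy the coupled
equations `u_h w u_h* = u*` and `w_k u w_k* = w*`, then with `r = max k h` and
`v := u_r* u* u_r` one has the polynomial matrix equation
`v_r u v_r* = u_r* u u_r`. -/
theorem stmt8 {A : Type*} [NormedRing A] [StarRing A] [CStarRing A]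
    [CompleteSpace A] [NormedAlgebra ℂ A] [StarModule ℂ A]
    {n : ℕ} (hn : 2 ≤ n) (S : Fin n → A)
    (hiso : ∀ i, star (S i) * S i = 1)
    (hcuntz : ∑ i, S i * star (S i) = 1)
    (k h : ℕ) (hk : 1 ≤ k) (hh : 1 ≤ h)
    (u w : A) (huF : u ∈ cuntzF S k) (hwF : w ∈ cuntzF S h)
    (hu : u ∈ unitary A) (hw : w ∈ unitary A)
    (heq1 : cuntzUk S u h * w * star (cuntzUk S u h) = star u)
    (heq2 : cuntzUk S w k * u * star (cuntzUk S w k) = star w) :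
    cuntzUk S (star (cuntzUk S u (max k h)) * star u * cuntzUk S u (max k h)) (max k h) * u *
        star (cuntzUk S (star (cuntzUk S u (max k h)) * star u * cuntzUk S u (max k h)) (max k h)) =
      star (cuntzUk S u (max k h)) * u * cuntzUk S u (max k h) := by
  let : CStarAlgebra A := {}
  have horth (i j : Fin n) : star (S i) * S j = if i = j then 1 else 0 := by
    split_ifs with hij
    · rw [hij, hiso]
    · exact cuntz_star_mul_of_ne hiso hcuntz hij
  have hur := cuntzUk_mem_unitary horth hcuntz hu (max k h)
  have hv : star (cuntzUk S u (max k h)) * star u * cuntzUk S u (max k h) = w := by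
    rw [← heq1, ← cuntzUk_conj_eq_of_le horth hcuntz hu (le_max_right k h) hwF]
    generalize cuntzUk S u (max k h) = x at hur
    rw [mul_assoc, mul_assoc (x * w), Unitary.star_mul_self_of_mem hur, mul_one, ← mul_assoc,
      Unitary.star_mul_self_of_mem hur, one_mul]
  rw [hv, cuntzUk_conj_eq_of_le horth hcuntz hw (le_max_left k h) huF, heq2, ← hv]
  simp only [star_mul, star_star, mul_assoc]
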